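/- arXiv:1904.00309 — 4 statements merged into one kernel-verified Lean document; each statement's English description precedes it below -/
import Mathlib

section
/- Let C₁ > 0 and define g(δ) = (−δ² + (1−δ)C₁) + √((δ² + (1−δ)C₁)² + 4δ³C₁) for δ > 0. Then δ† = (√(C₁² + 16C₁) − C₁)/4 is the unique global minimizer of g on (0, ∞). -/
/-- Gaussian case: `δ† = (√(C₁² + 16C₁) − C₁)/4` is the unique global minimizer on `(0,∞)`
of `g(δ) = (−δ² + (1−δ)C₁) + √((δ² + (1−δ)C₁)² + 4δ³C₁)`. -/
theorem stmt_3 (C1 : ℝ) (hC : 0 < C1)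
    (g : ℝ → ℝ)
    (hg : ∀ δ : ℝ, g δ = (-δ ^ 2 + (1 - δ) * C1)
      + Real.sqrt ((δ ^ 2 + (1 - δ) * C1) ^ 2 + 4 * δ ^ 3 * C1))
    (δopt : ℝ) (hδopt : δopt = (Real.sqrt (C1 ^ 2 + 16 * C1) - C1) / 4) :
    0 < δopt ∧ ∀ δ : ℝ, 0 < δ → g δopt ≤ g δ ∧ (g δopt = g δ → δ = δopt) := by
  have hsq : Real.sqrt (C1 ^ 2 + 16 * C1) ^ 2 = C1 ^ 2 + 16 * C1 := Real.sq_sqrt (by positivity)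
  have hlt : C1 < Real.sqrt (C1 ^ 2 + 16 * C1) := Real.lt_sqrt_of_sq_lt (by linarith)
  have hpos : 0 < δopt := by rw [hδopt]; linarith
  have hs : Real.sqrt (C1 ^ 2 + 16 * C1) = 4 * δopt + C1 := by rw [hδopt]; ring
  have hquad : δopt * C1 = 2 * C1 - 2 * δopt ^ 2 := by
    rw [hs] at hsq
    linarith
  have hgap : 0 < C1 - δopt ^ 2 := by
    have := mul_pos hpos hC
    linarith
  have hid : ∀ δ : ℝ, (δ ^ 2 + (1 - δ) * C1) ^ 2 + 4 * δ ^ 3 * C1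
      = (2 * δopt ^ 2 - (-δ ^ 2 + (1 - δ) * C1)) ^ 2
        + 4 * (C1 - δopt ^ 2) * (δ - δopt) ^ 2 := by
    intro δ
    linear_combination (-4 * δ * δopt) * hquad
  have hmin : g δopt = 2 * δopt ^ 2 := by
    have h : (δopt ^ 2 + (1 - δopt) * C1) ^ 2 + 4 * δopt ^ 3 * C1
        = (2 * δopt ^ 2 - (-δopt ^ 2 + (1 - δopt) * C1)) ^ 2 := by
      rw [hid]; ring
    rw [hg, h, Real.sqrt_sq (by nlinarith)]
    ring
  refine ⟨hpos, fun δ _ => ?_⟩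
  have hle : g δopt ≤ g δ := by
    rw [hmin, hg]
    have := Real.le_sqrt_of_sq_le (x := 2 * δopt ^ 2 - (-δ ^ 2 + (1 - δ) * C1))
      (y := (δ ^ 2 + (1 - δ) * C1) ^ 2 + 4 * δ ^ 3 * C1)
      (by rw [hid]; exact le_add_of_nonneg_right (by positivity))
    linarith
  refine ⟨hle, fun heq => ?_⟩
  by_contra hne
  have hne' : 0 < (δ - δopt) ^ 2 := sq_pos_of_ne_zero (sub_ne_zero.mpr hne)
  have := Real.lt_sqrt_of_sq_lt (x := 2 * δopt ^ 2 - (-δ ^ 2 + (1 - δ) * C1))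
    (y := (δ ^ 2 + (1 - δ) * C1) ^ 2 + 4 * δ ^ 3 * C1)
    (by rw [hid]; exact lt_add_of_pos_right _ (by positivity))
  rw [hmin, hg] at heq
  linarith
end

section
/- Let φ(x) = (1/√(2π))·exp(−x²/2) and Φ(x) = ∫_{−∞}^x φ(t) dt, and for ε ∈ (0,1], α ≥ 0 define M(ε,α) = ε(1+α²) + (1−ε)[2(1+α²)Φ(−α) − 2αφ(α)]. Then for every ε with 0 < ε < 1 there exists α > 0 such that M(ε,α) < 1; consequently inf_{α ≥ 0} M(ε,α) < 1 and hence 2·inf_{α ≥ 0} M(ε,α) < 2. -/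
open MeasureTheory

/-- Standard Gaussian density. -/
noncomputable def phi (x : ℝ) : ℝ := (1 / Real.sqrt (2 * Real.pi)) * Real.exp (-x ^ 2 / 2)

/-- Standard Gaussian cumulative distribution function. -/
noncomputable def Phi (x : ℝ) : ℝ := ∫ t in Set.Iic x, phi t

/-- Worst-case normalized MSE of soft thresholding, real domain. -/
noncomputable def Mre (ε α : ℝ) : ℝ :=
  ε * (1 + α ^ 2) + (1 - ε) * (2 * (1 + α ^ 2) * Phi (-α) - 2 * α * phi α)

lemma continuous_phi : Continuous phi := by
  unfold phi; fun_prop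

lemma phi_eq (x : ℝ) : phi x = (1 / √(2 * Real.pi)) * Real.exp (-(1 / 2) * x ^ 2) := by
  unfold phi; ring_nf

lemma phi_neg (x : ℝ) : phi (-x) = phi x := by simp [phi]

lemma phi_pos (x : ℝ) : 0 < phi x := by
  unfold phi; positivity

lemma integrable_phi : Integrable phi := by
  rw [funext phi_eq]
  exact (integrable_exp_neg_mul_sq (by norm_num)).const_mul _

lemma Phi_zero : Phi 0 = 1 / 2 := by
  have hsymm : ∫ t in Set.Iic (0 : ℝ), phi t = ∫ t in Set.Ioi (0 : ℝ), phi t := by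
    simpa [phi_neg] using integral_comp_neg_Iic (0 : ℝ) phi
  have hpi : √(2 * Real.pi) ≠ 0 := by positivity
  rw [Phi, hsymm, funext phi_eq, integral_const_mul, integral_gaussian_Ioi,
    show Real.pi / (1 / 2) = 2 * Real.pi by ring]
  field_simp

lemma hasDerivAt_Phi (x : ℝ) : HasDerivAt Phi (phi x) x := by
  have hPhi : Phi = fun b => (∫ t in (0 : ℝ)..b, phi t) + Phi 0 := by
    ext b
    rw [← intervalIntegral.integral_Iic_sub_Iic integrable_phi.integrableOn
      integrable_phi.integrableOn]
    simp [Phi]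
  rw [hPhi]
  exact (intervalIntegral.integral_hasDerivAt_right (continuous_phi.intervalIntegrable _ _)
    (continuous_phi.stronglyMeasurableAtFilter _ _) continuous_phi.continuousAt).add_const _

lemma hasDerivAt_phi (x : ℝ) : HasDerivAt phi (-x * phi x) x := by
  have h := ((hasDerivAt_pow 2 x).neg.div_const 2).exp.const_mul (1 / √(2 * Real.pi))
  refine h.congr_deriv ?_
  simp [phi]
  ring

lemma Mre_zero (ε : ℝ) : Mre ε 0 = 1 := by
  simp [Mre, Phi_zero]

lemma hasDerivAt_Mre_zero (ε : ℝ) : HasDerivAt (Mre ε) (-(4 * (1 - ε) * phi 0)) 0 := by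
  have hq : HasDerivAt (fun α : ℝ => 1 + α ^ 2) 0 0 := by
    simpa using (hasDerivAt_pow 2 (0 : ℝ)).const_add 1
  have hP : HasDerivAt (fun α : ℝ => Phi (-α)) (-phi 0) 0 := by
    simpa [Function.comp_def] using (hasDerivAt_Phi (-0)).scomp (0 : ℝ) (hasDerivAt_neg (0 : ℝ))
  have h := (hq.const_mul ε).add ((((hq.const_mul 2).mul hP).sub
    (((hasDerivAt_id (0 : ℝ)).const_mul 2).mul (hasDerivAt_phi 0))).const_mul (1 - ε))
  refine h.congr_deriv ?_
  simp
  ring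

lemma exists_pos_lt_of_hasDerivAt_neg {f : ℝ → ℝ} {f' : ℝ} (hf : HasDerivAt f f' 0)
    (hf' : f' < 0) : ∃ x, 0 < x ∧ f x < f 0 := by
  have hslope := (hasDerivAt_iff_tendsto_slope_zero.mp hf).eventually_lt_const hf'
  have hright := hslope.filter_mono (nhdsGT_le_nhdsNE (0 : ℝ))
  obtain ⟨x, hx, hx0⟩ := (hright.and self_mem_nhdsWithin).exists
  refine ⟨x, hx0, ?_⟩
  rw [zero_add, smul_eq_mul] at hx
  exact sub_neg.mp (neg_of_mul_neg_right hx (inv_nonneg.mpr (le_of_lt hx0)))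

/-- For every `0 < ε < 1` there is `α > 0` with `M(ε,α) < 1`; hence
`inf_{α ≥ 0} M(ε,α) < 1` and `2·inf_{α ≥ 0} M(ε,α) < 2` (so `δ† < 2`). -/
theorem stmt_6 (ε : ℝ) (h0 : 0 < ε) (h1 : ε < 1) :
    (∃ α : ℝ, 0 < α ∧ Mre ε α < 1) ∧
    sInf (Mre ε '' Set.Ici 0) < 1 ∧
    2 * sInf (Mre ε '' Set.Ici 0) < 2 := by
  have hex : ∃ α : ℝ, 0 < α ∧ Mre ε α < 1 := by
    rw [← Mre_zero ε]
    refine exists_pos_lt_of_hasDerivAt_neg (hasDerivAt_Mre_zero ε) (neg_neg_of_pos ?_)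
    have := sub_pos.mpr h1
    have := phi_pos 0
    positivity
  have hinf : sInf (Mre ε '' Set.Ici 0) < 1 := by
    obtain ⟨α, hα, hlt⟩ := hex
    by_cases hb : BddBelow (Mre ε '' Set.Ici 0)
    · exact (csInf_le hb (Set.mem_image_of_mem _ hα.le)).trans_lt hlt
    · rw [Real.sInf_of_not_bddBelow hb]
      exact one_pos
  exact ⟨hex, hinf, by linarith⟩
end

section
/- Let φ(x) = (1/√(2π))·exp(−x²/2). For R ∈ (0,1) and ε ∈ (0,1], define I(R,ε) = ∫_{−∞}^{∞} [φ(x)·x² / (1 + ((1−ε)/ε)·(1/√(1−R))·exp(−(R/(1−R))·x²/2))] dx. Then 0 < I(R,ε) ≤ 1 for all ε ∈ (0,1], and for fixed R ∈ (0,1), I(R,·) is strictly increasing in ε: if 0 < ε₁ < ε₂ ≤ 1 then I(R,ε₁) < I(R,ε₂); moreover I(R,1) = 1. -/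
open MeasureTheory

/-- The integral `I(R,ε)` appearing in the Bernoulli-Gaussian state evolution. -/
noncomputable def Ifun (R ε : ℝ) : ℝ :=
  ∫ x : ℝ, phi x * x ^ 2 /
    (1 + ((1 - ε) / ε) * (1 / Real.sqrt (1 - R)) * Real.exp (-(R / (1 - R)) * x ^ 2 / 2))

lemma integrable_phi_mul_sq : Integrable fun x : ℝ => phi x * x ^ 2 := by
  have h := (integrable_rpow_mul_exp_neg_mul_sq (b := 1 / 2) (by norm_num)
    (s := 2) (by norm_num)).const_mul (1 / Real.sqrt (2 * Real.pi))
  refine h.congr (.of_forall fun x => ?_)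
  have hx : -(1 / 2) * x ^ 2 = -x ^ 2 / 2 := by ring
  simp only [phi, Real.rpow_two, hx]
  ring

/-- The standard Gaussian has second moment one. -/
lemma integral_phi_mul_sq : ∫ x : ℝ, phi x * x ^ 2 = 1 := by
  have h := ProbabilityTheory.variance_fun_id_gaussianReal (μ := 0) (v := 1)
  rw [ProbabilityTheory.variance_of_integral_eq_zero measurable_id'.aemeasurable (by simp),
    ProbabilityTheory.integral_gaussianReal_eq_integral_smul one_ne_zero] at h
  simpa [phi, ProbabilityTheory.gaussianPDFReal] using h

section Weight

variable {g : ℝ → ℝ} {a b : ℝ}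

lemma continuous_phi_mul_sq_div (hg : Continuous g) (hg0 : ∀ x, 0 < g x) (ha : 0 ≤ a) :
    Continuous fun x : ℝ => phi x * x ^ 2 / (1 + a * g x) := by
  refine (continuous_phi.mul (by fun_prop)).div (by fun_prop) fun x => ?_
  have := hg0 x
  positivity

lemma integrable_phi_mul_sq_div (hg : Continuous g) (hg0 : ∀ x, 0 < g x) (ha : 0 ≤ a) :
    Integrable fun x : ℝ => phi x * x ^ 2 / (1 + a * g x) := by
  refine integrable_phi_mul_sq.mono'
    (continuous_phi_mul_sq_div hg hg0 ha).aestronglyMeasurable (.of_forall fun x => ?_)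
  have := hg0 x
  have := phi_pos x
  rw [Real.norm_of_nonneg (by positivity)]
  exact div_le_self (by positivity) (le_add_of_nonneg_right (by positivity))

lemma integral_phi_mul_sq_div_pos (hg : Continuous g) (hg0 : ∀ x, 0 < g x) (ha : 0 ≤ a) :
    0 < ∫ x : ℝ, phi x * x ^ 2 / (1 + a * g x) := by
  refine integral_pos_of_integrable_nonneg_nonzero (x := 1)
    (continuous_phi_mul_sq_div hg hg0 ha) (integrable_phi_mul_sq_div hg hg0 ha)
    (fun x => ?_) ?_
  · have := hg0 x
    have := phi_pos x
    simp only [Pi.zero_apply]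
    positivity
  · have := hg0 1
    have := phi_pos 1
    positivity

lemma integral_phi_mul_sq_div_strictAnti (hg : Continuous g) (hg0 : ∀ x, 0 < g x)
    (ha : 0 ≤ a) (hab : a < b) :
    ∫ x : ℝ, phi x * x ^ 2 / (1 + b * g x) < ∫ x : ℝ, phi x * x ^ 2 / (1 + a * g x) := by
  have hb : 0 ≤ b := ha.trans hab.le
  have hden (x : ℝ) : 1 + a * g x < 1 + b * g x := by
    have := mul_lt_mul_of_pos_right hab (hg0 x)
    linarith
  have hpos (x : ℝ) : 0 < 1 + a * g x := by
    have := hg0 x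
    positivity
  rw [← sub_pos, ← integral_sub (integrable_phi_mul_sq_div hg hg0 ha)
    (integrable_phi_mul_sq_div hg hg0 hb)]
  refine integral_pos_of_integrable_nonneg_nonzero (x := 1)
    ((continuous_phi_mul_sq_div hg hg0 ha).sub (continuous_phi_mul_sq_div hg hg0 hb))
    ((integrable_phi_mul_sq_div hg hg0 ha).sub (integrable_phi_mul_sq_div hg hg0 hb))
    (fun x => ?_) ?_
  · have := phi_pos x
    exact sub_nonneg.2 (div_le_div_of_nonneg_left (by positivity) (hpos x) (hden x).le)
  · have := phi_pos 1
    exact (sub_pos.2 (div_lt_div_of_pos_left (by positivity) (hpos 1) (hden 1))).ne'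

end Weight

/-- For `R ∈ (0,1)`: `0 < I(R,ε) ≤ 1` for all `ε ∈ (0,1]`, `I(R,·)` is strictly
increasing in `ε`, and `I(R,1) = 1`. -/
theorem stmt_10 (R : ℝ) (hR0 : 0 < R) (hR1 : R < 1) :
    (∀ ε : ℝ, 0 < ε → ε ≤ 1 → 0 < Ifun R ε ∧ Ifun R ε ≤ 1) ∧
    (∀ ε₁ ε₂ : ℝ, 0 < ε₁ → ε₁ < ε₂ → ε₂ ≤ 1 → Ifun R ε₁ < Ifun R ε₂) ∧
    Ifun R 1 = 1 := by
  have hs : 0 < 1 / Real.sqrt (1 - R) := one_div_pos.2 (Real.sqrt_pos.2 (sub_pos.2 hR1))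
  have hg : Continuous fun x : ℝ => Real.exp (-(R / (1 - R)) * x ^ 2 / 2) := by fun_prop
  have hg0 (x : ℝ) : 0 < Real.exp (-(R / (1 - R)) * x ^ 2 / 2) := Real.exp_pos _
  have hcoef {ε : ℝ} (h0 : 0 < ε) (h1 : ε ≤ 1) :
      0 ≤ (1 - ε) / ε * (1 / Real.sqrt (1 - R)) :=
    mul_nonneg (div_nonneg (sub_nonneg.2 h1) h0.le) hs.le
  have hmono (ε₁ ε₂ : ℝ) (h0 : 0 < ε₁) (h12 : ε₁ < ε₂) (h1 : ε₂ ≤ 1) :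
      Ifun R ε₁ < Ifun R ε₂ := by
    have h2 : 0 < ε₂ := h0.trans h12
    refine integral_phi_mul_sq_div_strictAnti hg hg0 (hcoef h2 h1)
      (mul_lt_mul_of_pos_right ?_ hs)
    rw [div_lt_div_iff₀ h2 h0]
    nlinarith
  have hone : Ifun R 1 = 1 := by
    simpa [Ifun] using integral_phi_mul_sq
  refine ⟨fun ε h0 h1 => ⟨integral_phi_mul_sq_div_pos hg hg0 (hcoef h0 h1), ?_⟩, hmono, hone⟩
  rcases h1.eq_or_lt with rfl | h
  · exact hone.le
  · exact hone ▸ (hmono ε 1 h0 h le_rfl).le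
end

section
/- Let σ_e² > 0, σ_x² > 0, ε ∈ (0,1], set R = σ_x²/(σ_x² + σ_e²), let p_G(t;0,σ²) = (1/√(2πσ²))·exp(−t²/(2σ²)), p₁(β) = p_G(β; 0, σ_x² + σ_e²), p(β) = (1−ε)·p_G(β; 0, σ_e²) + ε·p₁(β), and let I(R,ε) = ∫ φ(x)·x²/(1 + ((1−ε)/ε)·(1/√(1−R))·exp(−(R/(1−R))·x²/2)) dx with φ the standard Gaussian density. Then ∫_{−∞}^{∞} (ε·R·β·p₁(β))² / p(β) dβ = ε·σ_x²·R·I(R,ε), and consequently ε·σ_x² − ε·σ_x²·R·I(R,ε) = [R·ε/(1−R)]·(1 − R·I(R,ε))·σ_e². -/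
open MeasureTheory

/-- Centered Gaussian density with variance `σ²`. -/
noncomputable def pG (t σsq : ℝ) : ℝ :=
  (1 / Real.sqrt (2 * Real.pi * σsq)) * Real.exp (-t ^ 2 / (2 * σsq))

/-- Rescaling by the standard deviation turns a centered Gaussian density into `phi`. -/
lemma pG_sqrt_mul_self {S : ℝ} (hS : 0 < S) (γ : ℝ) : pG (√S * γ) S = phi γ / √S := by
  have hexp : -(√S * γ) ^ 2 / (2 * S) = -γ ^ 2 / 2 := by
    rw [mul_pow, Real.sq_sqrt hS.le]
    field_simp
  have hsqrt : √(2 * Real.pi * S) = √(2 * Real.pi) * √S := Real.sqrt_mul (by positivity) S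
  rw [pG, phi, hexp, hsqrt]
  field_simp

/-- A centered Gaussian density of variance `v`, evaluated at `√S * γ`, in terms of `phi γ`. -/
lemma pG_sqrt_mul {S v : ℝ} (hS : 0 < S) (hv : 0 < v) (γ : ℝ) :
    pG (√S * γ) v =
      phi γ / √S * (1 / √(v / S) * Real.exp (-((S - v) / v) * γ ^ 2 / 2)) := by
  have hexp : -(√S * γ) ^ 2 / (2 * v) = -γ ^ 2 / 2 + -((S - v) / v) * γ ^ 2 / 2 := by
    rw [mul_pow, Real.sq_sqrt hS.le]
    field_simp
    ring
  have hsqrt : √(2 * Real.pi * v) = √(2 * Real.pi) * √v := Real.sqrt_mul (by positivity) v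
  have hdiv : √(v / S) = √v / √S := Real.sqrt_div hv.le S
  have hvs : 0 < √v := Real.sqrt_pos.2 hv
  have hSs : 0 < √S := Real.sqrt_pos.2 hS
  rw [pG, phi, hexp, hsqrt, hdiv, Real.exp_add]
  field_simp

/-- MSE of the MMSE estimator for the real Bernoulli-Gaussian prior:
`∫ (εRβp₁(β))²/p(β) dβ = εσ_x²·R·I(R,ε)` and
`εσ_x² − εσ_x²·R·I(R,ε) = [Rε/(1−R)]·(1 − R·I(R,ε))·σ_e²`. -/
theorem stmt_14 (σesq σxsq ε : ℝ) (he : 0 < σesq) (hx : 0 < σxsq)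
    (hε0 : 0 < ε) (hε1 : ε ≤ 1)
    (R : ℝ) (hR : R = σxsq / (σxsq + σesq))
    (p1 p : ℝ → ℝ) (hp1 : ∀ β, p1 β = pG β (σxsq + σesq))
    (hp : ∀ β, p β = (1 - ε) * pG β σesq + ε * p1 β) :
    (∫ β : ℝ, (ε * R * β * p1 β) ^ 2 / p β) = ε * σxsq * R * Ifun R ε ∧
    ε * σxsq - ε * σxsq * R * Ifun R ε = (R * ε / (1 - R)) * (1 - R * Ifun R ε) * σesq := by
  have hS : 0 < σxsq + σesq := by positivity
  have h1R : 1 - R = σesq / (σxsq + σesq) := by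
    rw [hR]
    field_simp
    ring
  have hRR : R / (1 - R) = (σxsq + σesq - σesq) / σesq := by
    rw [h1R, hR]
    field_simp
    ring
  have hRS : R * (σxsq + σesq) = σxsq := by
    rw [hR]
    field_simp
  constructor
  · set s := √(σxsq + σesq) with hs
    have hs0 : 0 < s := Real.sqrt_pos.2 hS
    have hs2 : s ^ 2 = σxsq + σesq := Real.sq_sqrt hS.le
    have hscale := Measure.integral_comp_mul_left (fun β ↦ (ε * R * β * p1 β) ^ 2 / p β) s
    rw [abs_of_pos (inv_pos.2 hs0), smul_eq_mul, eq_inv_mul_iff_mul_eq₀ hs0.ne'] at hscale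
    rw [← hscale, Ifun, ← integral_const_mul, ← integral_const_mul]
    congr 1 with γ
    rw [hp, hp1, pG_sqrt_mul_self hS, pG_sqrt_mul hS he, ← hs, ← h1R, ← hRR]
    have hD : 0 ≤ 1 / √(1 - R) * Real.exp (-(R / (1 - R)) * γ ^ 2 / 2) := by positivity
    rw [mul_assoc ((1 - ε) / ε)]
    generalize 1 / √(1 - R) * Real.exp (-(R / (1 - R)) * γ ^ 2 / 2) = D at hD ⊢
    have hφ := phi_pos γ
    have hε : 0 ≤ 1 - ε := sub_nonneg.2 hε1
    have hden : (1 - ε) * (phi γ / s * D) + ε * (phi γ / s) =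
        phi γ / s * ε * (1 + (1 - ε) / ε * D) := by
      field_simp
      ring
    have hpos : 0 < 1 + (1 - ε) / ε * D := by positivity
    rw [hden, ← hRS, ← hs2]
    generalize 1 + (1 - ε) / ε * D = E at hpos ⊢
    field_simp
  · have hcoef : R * ε / (1 - R) * σesq = ε * σxsq := by
      rw [h1R, hR]
      field_simp
    linear_combination (-(1 - R * Ifun R ε)) * hcoef
end
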